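/- arXiv:2201.08339 — 8 statements merged into one kernel-verified Lean document; each statement's English description precedes it below -/
import Mathlib

section
/- Let R be a ring and Σ = {σ₁,…,σₙ} a finite family of non-unital ring endomorphisms of R. Then R is Σ-semicommutative if and only if R is σᵢ-semicommutative for every i ∈ {1,…,n}. -/
/-- A non-unital ring endomorphism: an additive and multiplicative map
(not required to send `1` to `1`). -/
def IsNUEnd {R : Type*} [Ring R] (σ : R → R) : Prop :=
  (∀ a b : R, σ (a + b) = σ a + σ b) ∧ (∀ a b : R, σ (a * b) = σ a * σ b)

/-- For a family `σ : Fin n → R → R` and `α ∈ ℕⁿ`, the composition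
`σ₁^{α₁} ∘ ⋯ ∘ σₙ^{αₙ}`. -/
def famPow {R : Type*} {n : ℕ} (σ : Fin n → R → R) (α : Fin n → ℕ) : R → R :=
  (List.ofFn (fun i => (σ i)^[α i])).foldr (· ∘ ·) id

/-- `R` is `Σ`-semicommutative: `a * b = 0` implies `a * r * σ^α(b) = 0`
for every `r ∈ R` and every `α ≠ 0`. -/
def SigmaSemicomm {R : Type*} [Ring R] {n : ℕ} (σ : Fin n → R → R) : Prop :=
  ∀ a b : R, a * b = 0 → ∀ r : R, ∀ α : Fin n → ℕ, α ≠ 0 → a * r * famPow σ α b = 0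

/-- `R` is `σ`-semicommutative (single endomorphism). -/
def SingleSemicomm {R : Type*} [Ring R] (σ : R → R) : Prop :=
  ∀ a b : R, a * b = 0 → ∀ r : R, a * r * σ b = 0

/-- `R` is `Σ`-rigid: `a * σ^α(a) = 0` implies `a = 0`. -/
def SigmaRigid {R : Type*} [Ring R] {n : ℕ} (σ : Fin n → R → R) : Prop :=
  ∀ (a : R) (α : Fin n → ℕ), a * famPow σ α a = 0 → a = 0

/-- `δ` is a `σ`-derivation of `R`. -/
def IsSigmaDerivation {R : Type*} [Ring R] (σ δ : R → R) : Prop :=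
  (∀ a b : R, δ (a + b) = δ a + δ b) ∧
    (∀ a b : R, δ (a * b) = σ a * δ b + δ a * b)

/-- The left annihilator `l_R(S)` of a subset `S ⊆ R`. -/
def leftAnn {R : Type*} [Ring R] (S : Set R) : Set R :=
  {x : R | ∀ s ∈ S, x * s = 0}

/-- The right annihilator `r_R(S)` of a subset `S ⊆ R`. -/
def rightAnn {R : Type*} [Ring R] (S : Set R) : Set R :=
  {x : R | ∀ s ∈ S, s * x = 0}

/-- `R` is Baer (left annihilator version): the left annihilator of every
nonempty subset is of the form `Re` for an idempotent `e`. -/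
def IsBaerLeft (R : Type*) [Ring R] : Prop :=
  ∀ S : Set R, S.Nonempty →
    ∃ e : R, e * e = e ∧ leftAnn S = {x : R | ∃ r : R, x = r * e}

/-- `R` is Baer (right annihilator version): the right annihilator of every
nonempty subset is of the form `eR` for an idempotent `e`. -/
def IsBaerRight (R : Type*) [Ring R] : Prop :=
  ∀ S : Set R, S.Nonempty →
    ∃ e : R, e * e = e ∧ rightAnn S = {x : R | ∃ r : R, x = e * r}

/-- `R` is quasi-Baer: the right annihilator of every right ideal
(an additive subgroup closed under right multiplication) is of the form `eR`
for an idempotent `e`. -/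
def IsQuasiBaer (R : Type*) [Ring R] : Prop :=
  ∀ I : AddSubgroup R, (∀ a ∈ I, ∀ r : R, a * r ∈ I) →
    ∃ e : R, e * e = e ∧ rightAnn (I : Set R) = {x : R | ∃ r : R, x = e * r}

theorem famPow_succ {R : Type*} {n : ℕ} (σ : Fin (n + 1) → R → R) (α : Fin (n + 1) → ℕ) :
    famPow σ α = (σ 0)^[α 0] ∘ famPow (fun i => σ i.succ) (fun i => α i.succ) := by
  simp [famPow, List.ofFn_succ]

theorem famPow_zero {R : Type*} {n : ℕ} (σ : Fin n → R → R) : famPow σ 0 = id := by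
  induction n with
  | zero => simp [famPow]
  | succ n ih =>
    rw [famPow_succ]
    exact ih _

theorem famPow_single {R : Type*} {n : ℕ} (σ : Fin n → R → R) (i : Fin n) :
    famPow σ (Pi.single i 1) = σ i := by
  induction n with
  | zero => exact i.elim0
  | succ n ih =>
    rw [famPow_succ]
    cases i using Fin.cases with
    | zero =>
      have h : (fun j : Fin n => (Pi.single 0 1 : Fin (n + 1) → ℕ) j.succ) = 0 := by
        ext j
        simp
      rw [h, famPow_zero]
      simp
    | succ i =>
      have h : (fun j : Fin n => (Pi.single i.succ 1 : Fin (n + 1) → ℕ) j.succ) =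
          Pi.single i 1 := by
        ext j
        simp [Pi.single_apply]
      rw [h, ih]
      simp

namespace SingleSemicomm

variable {R : Type*} [Ring R]

theorem mul_apply_eq_zero {σ : R → R} (h : SingleSemicomm σ) {a b : R} (hab : a * b = 0) :
    a * σ b = 0 := by
  simpa using h a b hab 1

theorem comp {σ τ : R → R} (hσ : SingleSemicomm σ) (hτ : SingleSemicomm τ) :
    SingleSemicomm (σ ∘ τ) :=
  fun a b hab => hσ a (τ b) (hτ.mul_apply_eq_zero hab)

theorem iterate {σ : R → R} (h : SingleSemicomm σ) {k : ℕ} (hk : k ≠ 0) :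
    SingleSemicomm σ^[k] := by
  induction k with
  | zero => exact absurd rfl hk
  | succ k ih =>
    by_cases h_zero : k = 0
    · subst h_zero
      exact h
    · exact (ih h_zero).comp h

theorem famPow {n : ℕ} {σ : Fin n → R → R} (h : ∀ i, SingleSemicomm (σ i))
    {α : Fin n → ℕ} (hα : α ≠ 0) : SingleSemicomm (famPow σ α) := by
  induction n with
  | zero => exact absurd (Subsingleton.elim α 0) hα
  | succ n ih =>
    rw [famPow_succ]
    by_cases h_tail : (fun i : Fin n => α i.succ) = 0
    · have h_head : α 0 ≠ 0 := fun h_head =>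
        hα (funext (Fin.cases h_head (congrFun h_tail)))
      rw [h_tail, famPow_zero]
      exact (h 0).iterate h_head
    · have h_rest := ih (fun i => h i.succ) h_tail
      by_cases h_head : α 0 = 0
      · rw [h_head]
        exact h_rest
      · exact ((h 0).iterate h_head).comp h_rest

end SingleSemicomm

/-- `R` is `Σ`-semicommutative iff `R` is `σᵢ`-semicommutative
for every `i`. -/
theorem sigma_semicomm_iff_forall {R : Type*} [Ring R] {n : ℕ}
    (σ : Fin n → R → R) (hσ : ∀ i, IsNUEnd (σ i)) :
    SigmaSemicomm σ ↔ ∀ i : Fin n, SingleSemicomm (σ i) := by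
  constructor
  · intro h i a b hab r
    have h_ne : (Pi.single i 1 : Fin n → ℕ) ≠ 0 := by simp
    simpa [famPow_single] using h a b hab r _ h_ne
  · intro h a b hab r α hα
    exact SingleSemicomm.famPow h hα a b hab r
end

section
/- Let Σ = {σ₁,…,σₙ} be a finite family of injective non-unital ring endomorphisms of a ring R, and suppose R is Σ-semicommutative. Then σ^α(1) = 1 for every α ∈ ℕⁿ. -/
/-- The identity and composites of injective non-unital endomorphisms are again such. -/
theorem foldr_comp_isNUEnd_injective {R : Type*} [Ring R] (l : List (R → R))
    (hl : ∀ f ∈ l, IsNUEnd f ∧ Function.Injective f) :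
    IsNUEnd (l.foldr (· ∘ ·) id) ∧ Function.Injective (l.foldr (· ∘ ·) id) := by
  induction l with
  | nil => exact ⟨⟨fun _ _ => rfl, fun _ _ => rfl⟩, Function.injective_id⟩
  | cons f l ih =>
    obtain ⟨⟨fadd, fmul⟩, finj⟩ := hl f (by simp)
    obtain ⟨⟨gadd, gmul⟩, ginj⟩ := ih fun g hg => hl g (by simp [hg])
    exact ⟨⟨fun a b => by simp [gadd, fadd], fun a b => by simp [gmul, fmul]⟩, finj.comp ginj⟩

/-- Iterates of a non-unital endomorphism are non-unital endomorphisms. -/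
theorem IsNUEnd.iterate {R : Type*} [Ring R] {f : R → R} (hf : IsNUEnd f) (k : ℕ) :
    IsNUEnd f^[k] := by
  induction k with
  | zero => exact ⟨fun _ _ => rfl, fun _ _ => rfl⟩
  | succ k ih =>
    exact ⟨fun a b => by simp [hf.1, ih.1], fun a b => by simp [hf.2, ih.2]⟩

theorem famPow_isNUEnd_injective {R : Type*} [Ring R] {n : ℕ} {σ : Fin n → R → R}
    (hσ : ∀ i, IsNUEnd (σ i)) (hinj : ∀ i, Function.Injective (σ i)) (α : Fin n → ℕ) :
    IsNUEnd (famPow σ α) ∧ Function.Injective (famPow σ α) := by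
  refine foldr_comp_isNUEnd_injective _ fun f hf => ?_
  obtain ⟨i, rfl⟩ := (List.mem_ofFn' _ _).mp hf
  exact ⟨(hσ i).iterate _, (hinj i).iterate _⟩

/-- if `R` is `Σ`-semicommutative (with all `σᵢ` injective),
then `σ^α(1) = 1` for every `α ∈ ℕⁿ`. -/
theorem sigma_semicomm_map_one {R : Type*} [Ring R] {n : ℕ}
    (σ : Fin n → R → R) (hσ : ∀ i, IsNUEnd (σ i))
    (hinj : ∀ i, Function.Injective (σ i))
    (hsc : SigmaSemicomm σ) :
    ∀ α : Fin n → ℕ, famPow σ α (1 : R) = 1 := by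
  intro α
  obtain ⟨⟨hadd, hmul⟩, hinjα⟩ := famPow_isNUEnd_injective hσ hinj α
  by_cases hα : α = 0
  · have hid (l : List (R → R)) (hl : ∀ f ∈ l, f = id) : l.foldr (· ∘ ·) id = id := by
      induction l with
      | nil => rfl
      | cons f l ih => simp_all
    exact congrFun (hid _ fun f hf => by
      obtain ⟨i, rfl⟩ := (List.mem_ofFn' _ _).mp hf
      simp [hα]) 1
  · have hidem : famPow σ α 1 * famPow σ α 1 = famPow σ α 1 := by rw [← hmul, mul_one]
    have hzero : famPow σ α 0 = 0 := by simpa using hadd 0 0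
    have hann := hsc (famPow σ α 1) (1 - famPow σ α 1)
      (by rw [mul_sub, mul_one, hidem, sub_self]) 1 α hα
    rw [mul_one, ← hmul, one_mul, ← hzero] at hann
    exact (sub_eq_zero.mp (hinjα hann)).symm
end

section
/- Let Σ = {σ₁,…,σₙ} be a finite family of injective non-unital ring endomorphisms of a ring R, and suppose R is Σ-semicommutative. Then σ^α(e) = e for every idempotent element e of R and every α ∈ ℕⁿ. -/
theorem IsNUEnd.id {R : Type*} [Ring R] : IsNUEnd (id : R → R) :=
  ⟨fun _ _ => rfl, fun _ _ => rfl⟩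

theorem IsNUEnd.comp {R : Type*} [Ring R] {f g : R → R} (hf : IsNUEnd f) (hg : IsNUEnd g) :
    IsNUEnd (f ∘ g) :=
  ⟨fun a b => by simp [hg.1, hf.1], fun a b => by simp [hg.2, hf.2]⟩

theorem IsNUEnd.map_sub {R : Type*} [Ring R] {f : R → R} (hf : IsNUEnd f) (a b : R) :
    f (a - b) = f a - f b := by
  rw [eq_sub_iff_add_eq, ← hf.1, sub_add_cancel]

theorem List.foldr_comp_induction {R : Type*} {P : (R → R) → Prop} (hid : P id)
    (hcomp : ∀ f g, P f → P g → P (f ∘ g)) (l : List (R → R)) (hl : ∀ f ∈ l, P f) :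
    P (l.foldr (· ∘ ·) id) := by
  induction l with
  | nil => exact hid
  | cons f l ih =>
    exact hcomp f (l.foldr (· ∘ ·) id) (hl f (by simp)) (ih fun g hg => hl g (by simp [hg]))

theorem IsNUEnd.famPow {R : Type*} [Ring R] {n : ℕ} {σ : Fin n → R → R}
    (hσ : ∀ i, IsNUEnd (σ i)) (α : Fin n → ℕ) : IsNUEnd (famPow σ α) := by
  refine List.foldr_comp_induction IsNUEnd.id (fun _ _ => IsNUEnd.comp) _ fun f hf => ?_
  obtain ⟨i, rfl⟩ := (List.mem_ofFn' _ _).1 hf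
  exact (hσ i).iterate _

theorem famPow_injective {R : Type*} {n : ℕ} {σ : Fin n → R → R}
    (hinj : ∀ i, Function.Injective (σ i)) (α : Fin n → ℕ) :
    Function.Injective (famPow σ α) := by
  refine List.foldr_comp_induction Function.injective_id
    (fun _ _ => Function.Injective.comp) _ fun f hf => ?_
  obtain ⟨i, rfl⟩ := (List.mem_ofFn' _ _).1 hf
  exact (hinj i).iterate _

theorem IsNUEnd.map_one_of_singleSemicomm {R : Type*} [Ring R] {τ : R → R} (hτ : IsNUEnd τ)
    (hinj : Function.Injective τ) (hsc : SingleSemicomm τ) : τ 1 = 1 := by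
  have hidem : τ 1 * τ 1 = τ 1 := by rw [← hτ.2, one_mul]
  have h := hsc (τ 1) (1 - τ 1) (by rw [mul_sub, mul_one, hidem, sub_self]) 1
  rw [mul_one, hτ.map_sub, mul_sub, hidem, ← hτ.2, one_mul, sub_eq_zero] at h
  exact (hinj h).symm

theorem IsNUEnd.map_idempotent_of_singleSemicomm {R : Type*} [Ring R] {τ : R → R}
    (hτ : IsNUEnd τ) (hinj : Function.Injective τ) (hsc : SingleSemicomm τ) {e : R}
    (he : e * e = e) : τ e = e := by
  have hone := hτ.map_one_of_singleSemicomm hinj hsc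
  have h₁ := hsc e (1 - e) (by rw [mul_sub, mul_one, he, sub_self]) 1
  have h₂ := hsc (1 - e) e (by rw [sub_mul, one_mul, he, sub_self]) 1
  rw [mul_one, hτ.map_sub, hone, mul_sub, mul_one, sub_eq_zero] at h₁
  rw [mul_one, sub_mul, one_mul, sub_eq_zero] at h₂
  exact h₂.trans h₁.symm

/-- if `R` is `Σ`-semicommutative (with all `σᵢ` injective),
then `σ^α(e) = e` for every idempotent `e` and every `α ∈ ℕⁿ`. -/
theorem sigma_semicomm_map_idempotent {R : Type*} [Ring R] {n : ℕ}
    (σ : Fin n → R → R) (hσ : ∀ i, IsNUEnd (σ i))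
    (hinj : ∀ i, Function.Injective (σ i))
    (hsc : SigmaSemicomm σ) :
    ∀ e : R, e * e = e → ∀ α : Fin n → ℕ, famPow σ α e = e := by
  intro e he α
  by_cases hα : α = 0
  · rw [hα, famPow_zero, id]
  · exact (IsNUEnd.famPow hσ α).map_idempotent_of_singleSemicomm (famPow_injective hinj α)
      (fun a b hab r => hsc a b hab r α hα) he
end

section
/- Let σ be a non-unital ring endomorphism of a ring R (not necessarily injective) such that R is σ-semicommutative. Then: (1) σ(1) = σ^k(1) for all k ≥ 2; (2) σ(e) = e·σ(e) = e·σ(1) = e·σ^k(e) for all k ≥ 2 and every idempotent e of R. -/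
/-- for a (not necessarily injective) `σ`-semicommutative ring:
(1) `σ(1) = σ^k(1)` for all `k ≥ 2`; (2) `σ(e) = e·σ(e) = e·σ(1) = e·σ^k(e)`
for all `k ≥ 2` and every idempotent `e`. -/
theorem single_semicomm_one_and_idem {R : Type*} [Ring R]
    (σ : R → R) (hσ : IsNUEnd σ) (hsc : SingleSemicomm σ) :
    (∀ k : ℕ, 2 ≤ k → σ 1 = σ^[k] (1 : R)) ∧
      (∀ k : ℕ, 2 ≤ k → ∀ e : R, e * e = e →
        σ e = e * σ e ∧ e * σ e = e * σ 1 ∧ e * σ 1 = e * σ^[k] e) := by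
  obtain ⟨hadd, hmul⟩ := hσ
  have hsub : ∀ e : R, σ (1 - e) = σ 1 - σ e := fun e ↦ by
    rw [eq_sub_iff_add_eq, ← hadd, sub_add_cancel]
  have hleft : ∀ e : R, e * e = e → σ e = e * σ e := fun e he ↦ by
    have h := hsc (1 - e) e (by rw [sub_mul, he, one_mul, sub_self]) 1
    rwa [mul_one, sub_mul, one_mul, sub_eq_zero] at h
  have hright : ∀ e : R, e * e = e → e * σ e = e * σ 1 := fun e he ↦ by
    have h := hsc e (1 - e) (by rw [mul_sub, he, mul_one, sub_self]) 1
    rw [mul_one, hsub, mul_sub, sub_eq_zero] at h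
    exact h.symm
  have hfix : ∀ e : R, e * e = e → σ (σ e) = σ e := fun e he ↦ by
    have hidem : σ e * σ e = σ e := by rw [← hmul, he]
    rw [hleft _ hidem, hright _ hidem, ← hmul, mul_one]
  have hiter : ∀ k : ℕ, 2 ≤ k → ∀ e : R, e * e = e → σ^[k] e = σ e := fun k hk e he ↦ by
    obtain ⟨m, rfl⟩ := Nat.exists_eq_succ_of_ne_zero (show k ≠ 0 by omega)
    rw [Function.iterate_succ_apply, Function.iterate_fixed (hfix e he)]
  refine ⟨fun k hk ↦ (hiter k hk 1 (one_mul 1)).symm, fun k hk e he ↦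
    ⟨hleft e he, hright e he, ?_⟩⟩
  rw [hiter k hk e he, hright e he]
end

section
/- Let σ be a non-unital ring endomorphism of a ring R with σ(1) = 1. If R is σ-semicommutative, then R is Abelian, i.e., every idempotent of R is central. -/
/-- if `σ(1) = 1` and `R` is `σ`-semicommutative, then
`R` is Abelian. -/
theorem single_semicomm_abelian {R : Type*} [Ring R]
    (σ : R → R) (hσ : IsNUEnd σ) (h1 : σ 1 = 1)
    (hsc : SingleSemicomm σ) :
    ∀ e : R, e * e = e → ∀ r : R, e * r = r * e := by
  intro e he r
  have hσ' : σ (1 - e) = 1 - σ e := by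
    rw [eq_sub_iff_add_eq, ← hσ.1, sub_add_cancel, h1]
  have hl : ∀ x : R, e * x = e * x * σ e := fun x => by
    have h := hsc e (1 - e) (by rw [mul_sub, mul_one, he, sub_self]) x
    rwa [hσ', mul_sub, mul_one, sub_eq_zero] at h
  have hr : ∀ x : R, x * σ e = e * x * σ e := fun x => by
    have h := hsc (1 - e) e (by rw [sub_mul, one_mul, he, sub_self]) x
    rwa [sub_mul, one_mul, sub_mul, sub_eq_zero] at h
  have hfix : σ e = e := by
    have h := (hr 1).trans (hl 1).symm
    rwa [one_mul, mul_one] at h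
  calc e * r = r * σ e := (hl r).trans (hr r).symm
    _ = r * e := by rw [hfix]
end

section
/- Let σ be a non-unital ring endomorphism of a ring R. Then R is σ-rigid if and only if R is a σ-semicommutative reduced ring and σ is injective. -/
/-- In a reduced ring, products that vanish also vanish in the opposite order. -/
theorem mul_eq_zero_swap_of_isReduced {R : Type*} [Ring R] [IsReduced R] {a b : R}
    (h : a * b = 0) : b * a = 0 := by
  refine IsReduced.eq_zero _ ⟨2, ?_⟩
  rw [pow_two, mul_assoc, ← mul_assoc a, h, zero_mul, mul_zero]

theorem IsNUEnd.map_zero {R : Type*} [Ring R] {σ : R → R} (hσ : IsNUEnd σ) : σ 0 = 0 := by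
  simpa using hσ.1 0 0

/-- `R` is `σ`-rigid iff `R` is a `σ`-semicommutative reduced
ring and `σ` is injective. -/
theorem single_rigid_iff {R : Type*} [Ring R]
    (σ : R → R) (hσ : IsNUEnd σ) :
    (∀ a : R, a * σ a = 0 → a = 0) ↔
      (SingleSemicomm σ ∧ IsReduced R ∧ Function.Injective σ) := by
  have h_zero := hσ.map_zero
  constructor
  · intro h
    have vanish : ∀ a b : R, b * a = 0 → a * σ b = 0 := by
      intro a b hba
      apply h
      rw [hσ.2, mul_assoc, ← mul_assoc (σ b), ← hσ.2, hba, h_zero, zero_mul, mul_zero]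
    have hred : IsReduced R := by
      refine (isReduced_iff_pow_one_lt 2 one_lt_two).2 fun a ha => h a (vanish a a ?_)
      rwa [← pow_two]
    refine ⟨fun a b hab r => vanish _ _ ?_, hred, fun a b hab => ?_⟩
    · rw [← mul_assoc, mul_eq_zero_swap_of_isReduced hab, zero_mul]
    · refine sub_eq_zero.1 (h _ ?_)
      have hsub : σ (a - b) = 0 := by
        have h_add := hσ.1 (a - b) b
        rwa [sub_add_cancel, hab, right_eq_add] at h_add
      rw [hsub, mul_zero]
  · rintro ⟨hsemi, hred, hinj⟩ a ha
    have hsq := hsemi _ _ (mul_eq_zero_swap_of_isReduced ha) 1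
    rw [mul_one, ← pow_two] at hsq
    exact hinj ((IsReduced.eq_zero _ ⟨2, hsq⟩).trans h_zero.symm)
end

section
/- Let Σ = {σ₁,…,σₙ} be a finite family of injective non-unital ring endomorphisms of a ring R, and suppose R is Σ-semicommutative and Baer. Then for every nonempty subset S of R and every i ∈ {1,…,n}, σᵢ(l_R(S)) ⊆ l_R(S). -/
theorem SigmaSemicomm.singleSemicomm {R : Type*} [Ring R] {n : ℕ} {σ : Fin n → R → R}
    (hsc : SigmaSemicomm σ) (i : Fin n) : SingleSemicomm (σ i) := by
  intro a b hab r
  have h := hsc a b hab r (Pi.single i 1) (by simp)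
  rwa [famPow_single] at h

/-- An endomorphism witnessing semicommutativity satisfies `r * σ e = e * r * σ 1` for every
idempotent `e`. -/
theorem SingleSemicomm.mul_map_idempotent {R : Type*} [Ring R] {σ : R → R} (hσ : IsNUEnd σ)
    (hsc : SingleSemicomm σ) {e : R} (he : e * e = e) (r : R) :
    r * σ e = e * r * σ 1 := by
  have h₁ := hsc (1 - e) e (by rw [sub_mul, one_mul, he, sub_self]) r
  have h₂ := hsc e (1 - e) (by rw [mul_sub, mul_one, he, sub_self]) r
  have h₃ : σ 1 = σ (1 - e) + σ e := by rw [← hσ.1, sub_add_cancel]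
  rw [h₃, mul_add, h₂, zero_add]
  rwa [sub_mul, sub_mul, one_mul, sub_eq_zero] at h₁

/-- Idempotents are central in a ring that is semicommutative with respect to an injective
endomorphism. -/
theorem SingleSemicomm.idempotent_central {R : Type*} [Ring R] {σ : R → R} (hσ : IsNUEnd σ)
    (hinj : Function.Injective σ) (hsc : SingleSemicomm σ) {e : R} (he : e * e = e) (r : R) :
    e * r = r * e := by
  have key := hsc.mul_map_idempotent hσ he
  have hmul := hσ.2
  apply hinj
  have h₁ : σ e = e * σ 1 := by simpa using key 1
  calc σ (e * r) = e * (σ 1 * σ r) := by rw [hmul, h₁, mul_assoc]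
    _ = e * σ r * σ 1 := by rw [mul_assoc, ← hmul, ← hmul, one_mul, mul_one]
    _ = σ (r * e) := by rw [← key, hmul]

/-- in a `Σ`-semicommutative Baer ring,
`σᵢ(l_R(S)) ⊆ l_R(S)` for every nonempty `S` and every `i`. -/
theorem sigma_semicomm_baer_sigma_leftAnn {R : Type*} [Ring R] {n : ℕ}
    (σ : Fin n → R → R) (hσ : ∀ i, IsNUEnd (σ i))
    (hinj : ∀ i, Function.Injective (σ i))
    (hsc : SigmaSemicomm σ) (hB : IsBaerLeft R) :
    ∀ S : Set R, S.Nonempty → ∀ i : Fin n,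
      σ i '' leftAnn S ⊆ leftAnn S := by
  rintro S hS i _ ⟨x, hx, rfl⟩ s hs
  obtain ⟨e, he, hSe⟩ := hB S hS
  have hsc' := hsc.singleSemicomm i
  obtain ⟨r, rfl⟩ : ∃ r : R, x = r * e := by
    rwa [hSe] at hx
  have he_mem : e ∈ leftAnn S := hSe ▸ ⟨1, (one_mul e).symm⟩
  have central := hsc'.idempotent_central (hσ i) (hinj i) he
  rw [(hσ i).2, hsc'.mul_map_idempotent (hσ i) he, mul_assoc e, central, mul_assoc, he_mem s hs,
    mul_zero]
end

section
/- Let Σ = {σ₁,…,σₙ} be a finite family of injective non-unital ring endomorphisms of a ring R with R Σ-semicommutative and Baer, and let Δ = {δ₁,…,δₙ} be a family of maps where each δᵢ is a σᵢ-derivation of R. Then for every nonempty subset S of R and every i ∈ {1,…,n}, δᵢ(l_R(S)) ⊆ l_R(S). -/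
theorem foldr_comp_ofFn_eq_id {X : Type*} {n : ℕ} (f : Fin n → X → X) (h : ∀ j, f j = id) :
    (List.ofFn f).foldr (· ∘ ·) id = id := by
  induction n with
  | zero => simp
  | succ n ih =>
    rw [List.ofFn_succ, List.foldr_cons, ih _ fun j => h j.succ, h, Function.id_comp]

theorem foldr_comp_ofFn_eq_of_forall_ne {X : Type*} {n : ℕ} (f : Fin n → X → X) (i : Fin n)
    (h : ∀ j, j ≠ i → f j = id) :
    (List.ofFn f).foldr (· ∘ ·) id = f i := by
  induction n with
  | zero => exact i.elim0
  | succ n ih =>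
    rw [List.ofFn_succ, List.foldr_cons]
    cases i using Fin.cases with
    | zero =>
      rw [foldr_comp_ofFn_eq_id _ fun j => h j.succ (Fin.succ_ne_zero j), Function.comp_id]
    | succ i =>
      rw [ih (fun j => f j.succ) i fun j hj => h j.succ fun e => hj (Fin.succ_injective _ e),
        h 0 (Fin.succ_ne_zero i).symm, Function.id_comp]

theorem SigmaSemicomm.single {R : Type*} [Ring R] {n : ℕ} {σ : Fin n → R → R}
    (h : SigmaSemicomm σ) (i : Fin n) : SingleSemicomm (σ i) := by
  intro a b hab r
  have := h a b hab r (Pi.single i 1) (by simp)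
  rwa [famPow_single] at this

theorem SingleSemicomm.isReduced {R : Type*} [Ring R] {σ : R → R} (hsc : SingleSemicomm σ)
    (hσ : IsNUEnd σ) (hinj : Function.Injective σ) (hB : IsBaerLeft R) : IsReduced R := by
  rw [isReduced_iff_pow_one_lt 2 one_lt_two]
  intro a ha
  obtain ⟨e, he, hann⟩ := hB {a} ⟨a, rfl⟩
  have ha_mem : a ∈ leftAnn {a} := by
    rintro s rfl
    rw [← sq, ha]
  have he_mem : e ∈ leftAnn {a} := hann ▸ ⟨e, he.symm⟩
  have hea : e * a = 0 := he_mem a rfl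
  rw [hann] at ha_mem
  obtain ⟨r, hr⟩ := ha_mem
  have hae : a * e = a := by rw [hr, mul_assoc, he]
  have h₁ : e * σ a = 0 := by simpa using hsc e a hea 1
  have h₂ : (1 - e) * σ a * σ e = 0 := hsc (1 - e) e (by rw [sub_mul, he, one_mul, sub_self]) (σ a)
  rw [sub_mul, h₁, one_mul, sub_zero, ← hσ.2, hae] at h₂
  exact hinj (h₂.trans hσ.map_zero.symm)

theorem IsSigmaDerivation.map_mul_idem {R : Type*} [Ring R] [IsReduced R] {σ δ : R → R}
    (hδ : IsSigmaDerivation σ δ) (hsc : SingleSemicomm σ) {e : R}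
    (he : e * e = e) {x : R} (hx : x * e = x) : δ x * e = δ x := by
  have hcomm : ∀ r : R, e * r = r * e := by
    intro r
    have h₁ : e * r * (1 - e) = 0 := by
      refine IsReduced.eq_zero _ ⟨2, ?_⟩
      have : (1 - e) * e = 0 := by rw [sub_mul, he, one_mul, sub_self]
      calc (e * r * (1 - e)) ^ 2 = e * r * ((1 - e) * e) * r * (1 - e) := by noncomm_ring
        _ = 0 := by simp [this]
    have h₂ : (1 - e) * r * e = 0 := by
      refine IsReduced.eq_zero _ ⟨2, ?_⟩
      have : e * (1 - e) = 0 := by rw [mul_sub, he, mul_one, sub_self]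
      calc ((1 - e) * r * e) ^ 2 = (1 - e) * r * (e * (1 - e)) * r * e := by noncomm_ring
        _ = 0 := by simp [this]
    rw [mul_sub, mul_one, sub_eq_zero] at h₁
    rw [sub_mul, one_mul, sub_mul, sub_eq_zero] at h₂
    rw [h₁, h₂]
  have hσe : e * σ e = σ e := by
    have h := hsc (1 - e) e (by rw [sub_mul, he, one_mul, sub_self]) 1
    rw [mul_one, sub_mul, one_mul, sub_eq_zero] at h
    exact h.symm
  have hδe : δ e * e = δ e := by
    have h := hδ.2 e e
    rw [he] at h
    rw [h, add_mul, mul_assoc (δ e), he, ← hcomm, ← mul_assoc, hσe]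
  have h := hδ.2 x e
  rw [hx] at h
  rw [h, add_mul, mul_assoc, hδe, mul_assoc, he]

/-- in a `Σ`-semicommutative Baer ring with `σᵢ`-derivations
`δᵢ`, one has `δᵢ(l_R(S)) ⊆ l_R(S)` for every nonempty `S` and every `i`. -/
theorem sigma_semicomm_baer_delta_leftAnn {R : Type*} [Ring R] {n : ℕ}
    (σ : Fin n → R → R) (δ : Fin n → R → R)
    (hσ : ∀ i, IsNUEnd (σ i)) (hinj : ∀ i, Function.Injective (σ i))
    (hδ : ∀ i, IsSigmaDerivation (σ i) (δ i))
    (hsc : SigmaSemicomm σ) (hB : IsBaerLeft R) :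
    ∀ S : Set R, S.Nonempty → ∀ i : Fin n,
      δ i '' leftAnn S ⊆ leftAnn S := by
  rintro S hS i _ ⟨x, hx, rfl⟩
  have hsi := hsc.single i
  have := hsi.isReduced (hσ i) (hinj i) hB
  obtain ⟨e, he, hann⟩ := hB S hS
  rw [hann] at hx ⊢
  obtain ⟨r, rfl⟩ := hx
  exact ⟨_, ((hδ i).map_mul_idem hsi he (by rw [mul_assoc, he])).symm⟩
end
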